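/- Let A be an enriched matrix. If A contains none of D_2, D_3, nor their dual matrices as subconfigurations, then for every two nonempty rows of A that are colored with distinct colors and labeled one with L and the other with R, every nonempty LR-row of A shares a 1-column with at least one of these two rows. -/

import Mathlib

/-- Labels for rows of an enriched matrix. -/
inductive RowLabel : Type
  | L | R | LR
deriving DecidableEq

/-- Colors for rows/blocks of an enriched matrix. -/
inductive RowColor : Type
  | red | blue
deriving DecidableEq

/-- An enriched matrix: a (0,1)-matrix whose rows may carry an optional label in
{L, R, LR} and an optional color in {red, blue}, where only L-rows, R-rows and
all-zero LR-rows may be colored, and all colored all-zero LR-rows have the same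
color. -/
structure EnrichedMatrix (m n : ℕ) : Type where
  entry : Fin m → Fin n → Bool
  label : Fin m → Option RowLabel
  color : Fin m → Option RowColor
  color_rows : ∀ i, (color i).isSome = true →
    label i = some RowLabel.L ∨ label i = some RowLabel.R ∨
      (label i = some RowLabel.LR ∧ ∀ j, entry i j = false)
  lr_color_unique : ∀ i k, label i = some RowLabel.LR → label k = some RowLabel.LR →
    (color i).isSome = true → (color k).isSome = true → color i = color k

namespace EnrichedMatrix

variable {m n : ℕ} (A : EnrichedMatrix m n)

/-- Two rows are disjoint: they share no 1-column. -/
def RowDisj (i k : Fin m) : Prop := ∀ j, ¬(A.entry i j = true ∧ A.entry k j = true)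

/-- Row `i` is contained in row `k`. -/
def RowLe (i k : Fin m) : Prop := ∀ j, A.entry i j = true → A.entry k j = true

/-- Two rows are nested: one is contained in the other. -/
def RowNested (i k : Fin m) : Prop := A.RowLe i k ∨ A.RowLe k i

/-- A row is nonempty: it has at least one 1. -/
def RowNonempty (i : Fin m) : Prop := ∃ j, A.entry i j = true

/-- Rows `i` and `k` are both colored, with the same color. -/
def SameColor (i k : Fin m) : Prop := ∃ c, A.color i = some c ∧ A.color k = some c

/-- Rows `i` and `k` are both colored, with distinct colors. -/
def DistinctColors (i k : Fin m) : Prop :=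
  ∃ c d, A.color i = some c ∧ A.color k = some d ∧ c ≠ d

end EnrichedMatrix

namespace EnrichedMatrix

/-- `A` contains `D_2` (or, equivalently up to permutations, its dual) as a
subconfiguration. -/
def ContainsD2 {m n : ℕ} (A : EnrichedMatrix m n) : Prop :=
  ∃ (i₁ i₂ : Fin m) (j₁ j₂ : Fin n), j₁ ≠ j₂ ∧
    A.label i₁ = some RowLabel.L ∧ A.label i₂ = some RowLabel.R ∧
    A.DistinctColors i₁ i₂ ∧
    A.entry i₁ j₁ = true ∧ A.entry i₁ j₂ = false ∧
    A.entry i₂ j₁ = true ∧ A.entry i₂ j₂ = false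

/-- `A` contains `D_3` (or, equivalently up to permutations, its dual) as a
subconfiguration: rows (100) labeled L and (001) labeled R colored with distinct
colors, and a row (010) labeled LR and uncolored. -/
def ContainsD3 {m n : ℕ} (A : EnrichedMatrix m n) : Prop :=
  ∃ (i₁ i₂ i₃ : Fin m) (j₁ j₂ j₃ : Fin n), j₁ ≠ j₂ ∧ j₁ ≠ j₃ ∧ j₂ ≠ j₃ ∧
    A.label i₁ = some RowLabel.L ∧ A.label i₂ = some RowLabel.R ∧
    A.label i₃ = some RowLabel.LR ∧ A.DistinctColors i₁ i₂ ∧ A.color i₃ = none ∧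
    A.entry i₁ j₁ = true ∧ A.entry i₁ j₂ = false ∧ A.entry i₁ j₃ = false ∧
    A.entry i₂ j₁ = false ∧ A.entry i₂ j₂ = false ∧ A.entry i₂ j₃ = true ∧
    A.entry i₃ j₁ = false ∧ A.entry i₃ j₂ = true ∧ A.entry i₃ j₃ = false

end EnrichedMatrix

/-- If `A` contains none of `D_2`, `D_3`, nor their duals as subconfigurations, then
for every two nonempty rows colored with distinct colors and labeled one with L and
the other with R, every nonempty LR-row shares a 1-column with one of these two rows. -/
theorem no_D2_D3_implies {m n : ℕ} (A : EnrichedMatrix m n)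
    (h₂ : ¬ A.ContainsD2) (h₃ : ¬ A.ContainsD3) :
    ∀ i k r : Fin m, A.label i = some RowLabel.L → A.label k = some RowLabel.R →
      A.DistinctColors i k → A.RowNonempty i → A.RowNonempty k →
      A.label r = some RowLabel.LR → A.RowNonempty r →
      (∃ j, A.entry r j = true ∧ A.entry i j = true) ∨
      (∃ j, A.entry r j = true ∧ A.entry k j = true) := by
  intro i k r hi hk hd ⟨j₁, h₁⟩ ⟨j₃, hj₃⟩ hr ⟨j₂, hj₂⟩
  by_contra! h
  obtain ⟨hri, hrk⟩ := h
  have hrc : A.color r = none := by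
    by_contra hc
    rcases A.color_rows r (Option.isSome_iff_ne_none.mpr hc) with h | h | ⟨-, h⟩
    · simp [hr] at h
    · simp [hr] at h
    · simp [h j₂] at hj₂
  have hi₂ : A.entry i j₂ = false := by simpa using hri j₂ hj₂
  have hk₂ : A.entry k j₂ = false := by simpa using hrk j₂ hj₂
  have hik : ∀ j, A.entry i j = true → A.entry k j = false := by
    intro j hij
    by_contra hkj
    exact h₂ ⟨i, k, j, j₂, by grind, hi, hk, hd, hij, hi₂, by simpa using hkj, hk₂⟩
  exact h₃ ⟨i, k, r, j₁, j₂, j₃, by grind, by grind, by grind, hi, hk, hr, hd, hrc,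
    h₁, hi₂, by grind, hik j₁ h₁, hk₂, hj₃, by grind, hj₂, by grind⟩
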